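/- Let k ≥ 1, p ≥ k and q ≥ p be integers. Then: (i) γ(q,q,k) = 1; (ii) if p > k, then γ(q,p,k) ≥ γ(q−p+k, k, k); (iii) if p = k < q, then the number (T(q,k)+1)/2 is an integer, the set Γ((T(q,k)+1)/2, 1, q, k, k) is nonempty, and consequently γ(q,k,k) ≥ 2/(T(q,k)+1) = 2/(Σ_{r=0}^{k} C(q,r)·C(q−1−r,k−r) + 1). -/

import Mathlib

/-- `T(a,b) = Σ_{r=0}^{b} C(a,r)·C(a−1−r, b−r)`. -/
def T (a b : ℕ) : ℕ :=
  ∑ r ∈ Finset.range (b + 1), Nat.choose a r * Nat.choose (a - 1 - r) (b - r)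

/-- `(Ψ, Φ)` is a `(q,p)`-alphabet reduction pair of arrays (ARPA) of strength `k`:
both arrays have `R` rows, `q` columns indexed by `Σ_q` and entries in `Σ_q`;
`Φ` contains at least one row equal to `(0, 1, ..., q-1)` (i.e. the identity);
every row of `Ψ` takes at most `p` pairwise distinct values; and for every `k` pairwise
distinct columns and every `v ∈ Σ_q^k`, `Ψ` and `Φ` have the same number of rows whose
restriction to these columns equals `v`. -/
def IsARPA (q p k R : ℕ) (Ψ Φ : Fin R → Fin q → Fin q) : Prop :=
  (∃ r, ∀ j : Fin q, Φ r j = j) ∧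
  (∀ r, (Finset.univ.image (Ψ r)).card ≤ p) ∧
  (∀ c : Fin k → Fin q, StrictMono c → ∀ v : Fin k → Fin q,
    (Finset.univ.filter fun r => ∀ s, Ψ r (c s) = v s).card =
      (Finset.univ.filter fun r => ∀ s, Φ r (c s) = v s).card)

/-- `Γ(R, R*, q, p, k)` is nonempty: there is a `(q,p)`-ARPA of strength `k` with `R` rows
in which the row `(0, 1, ..., q-1)` occurs exactly `R*` times in `Φ`. -/
def GammaNonempty (R Rstar q p k : ℕ) : Prop :=
  ∃ Ψ Φ : Fin R → Fin q → Fin q, IsARPA q p k R Ψ Φ ∧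
    (Finset.univ.filter fun r => ∀ j : Fin q, Φ r j = j).card = Rstar

/-- `γ(q,p,k)`: the supremum of `R*/R` over all integers `R ≥ R* > 0` such that
`Γ(R, R*, q, p, k)` is nonempty. -/
noncomputable def gammaARPA (q p k : ℕ) : ℝ :=
  sSup {x : ℝ | ∃ R Rstar : ℕ, 0 < Rstar ∧ Rstar ≤ R ∧ GammaNonempty R Rstar q p k ∧
    x = (Rstar : ℝ) / R}

theorem T_zero_right (n : ℕ) : T n 0 = 1 := by simp [T]

theorem T_self (n : ℕ) : T n n = 1 := by
  unfold T
  rw [Finset.sum_range_succ, Finset.sum_eq_zero]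
  · simp
  · intro r hr
    rw [Finset.mem_range] at hr
    rw [Nat.choose_eq_zero_of_lt (show n - 1 - r < n - r by omega), mul_zero]

theorem T_succ_succ (n k : ℕ) (h : k < n) : T (n + 1) (k + 1) = T n (k + 1) + 2 * T n k := by
  have pascal : ∀ r ∈ Finset.range (k + 1),
      n.choose r * (n - r).choose (k + 1 - r) =
        n.choose r * (n - 1 - r).choose (k + 1 - r) + n.choose r * (n - 1 - r).choose (k - r) := by
    intro r hr
    rw [Finset.mem_range] at hr
    obtain ⟨a, ha⟩ : ∃ a, n - r = a + 1 := ⟨n - r - 1, by omega⟩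
    rw [ha, show n - 1 - r = a by omega, show k + 1 - r = (k - r) + 1 by omega,
      Nat.choose_succ_succ]
    ring
  have hsplit : T (n + 1) (k + 1) =
      (∑ r ∈ Finset.range (k + 2), n.choose r * (n - r).choose (k + 1 - r)) + T n k := by
    unfold T
    rw [Finset.sum_range_succ', Finset.sum_range_succ' (n := k + 1), add_right_comm,
      ← Finset.sum_add_distrib]
    congr 1
    · refine Finset.sum_congr rfl fun r _ => ?_
      rw [Nat.choose_succ_succ, show n + 1 - 1 - (r + 1) = n - 1 - r by omega,
        show n - (r + 1) = n - 1 - r by omega, show k + 1 - (r + 1) = k - r by omega]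
      ring
    · simp
  rw [hsplit, Finset.sum_range_succ, Finset.sum_congr rfl pascal, Finset.sum_add_distrib]
  unfold T
  rw [Finset.sum_range_succ _ (k + 1)]
  simp
  ring

/-- Signed families of rows on `n` columns: `P` (counted positively) and `N` (counted negatively)
agree together with the identity row on any `k` columns, and satisfy the bounds on the number of
values which make the family extendable by one column. -/
structure IsReduction (n k : ℕ) (P N : List (ℕ → ℕ)) : Prop where
  sum_eq : ∀ J : Finset ℕ, J ⊆ Finset.range n → J.card ≤ k → ∀ F : (ℕ → ℕ) → ℤ,
    DependsOn F (J : Set ℕ) → (P.map F).sum = (N.map F).sum + F id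
  pos_lt : ∀ w ∈ P, ∀ j < n, w j < n
  neg_lt : ∀ w ∈ N, ∀ j < n, w j < n
  card_pos : ∀ w ∈ P, ((Finset.range n).image w).card ≤ k
  card_neg : ∀ w ∈ N, (insert 0 ((Finset.range n).image w)).card ≤ k + 1
  neg_ne_id : ∀ w ∈ N, ∃ j < n, w j ≠ j

theorem IsReduction.length_eq {n k : ℕ} {P N : List (ℕ → ℕ)} (h : IsReduction n k P N) :
    P.length = N.length + 1 := by
  have := h.sum_eq ∅ (by simp) (by simp) (fun _ => 1) (fun _ _ _ => rfl)
  simp at this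
  exact_mod_cast this

theorem isReduction_self (n : ℕ) : IsReduction n n [id] [] where
  sum_eq := by intros; simp
  pos_lt := by simp
  neg_lt := by simp
  card_pos := by simp
  card_neg := by simp
  neg_ne_id := by simp

theorem image_range_succ_update (w : ℕ → ℕ) (n a : ℕ) :
    (Finset.range (n + 1)).image (Function.update w n a) =
      insert a ((Finset.range n).image w) := by
  rw [Finset.range_add_one, Finset.image_insert, Function.update_self]
  congr 1
  refine Finset.image_congr fun j hj => ?_
  rw [Finset.mem_coe, Finset.mem_range] at hj
  exact Function.update_of_ne hj.ne _ _

theorem update_lt {w : ℕ → ℕ} {n a : ℕ} (hw : ∀ j < n, w j < n + 1) (ha : a < n + 1) :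
    ∀ j < n + 1, Function.update w n a j < n + 1 := by
  intro j hj
  by_cases h : j = n
  · subst h; simpa using ha
  · rw [Function.update_of_ne h]; exact hw j (by omega)

theorem IsReduction.extend {n k : ℕ} {P N P₁ N₁ : List (ℕ → ℕ)} (hn : 0 < n)
    (h : IsReduction n (k + 1) P N)
    (sum_eq : ∀ J : Finset ℕ, J ⊆ Finset.range n → J.card ≤ k → ∀ F : (ℕ → ℕ) → ℤ,
      DependsOn F (J : Set ℕ) → (P₁.map F).sum = (N₁.map F).sum + F id)
    (pos_lt : ∀ w ∈ P₁, ∀ j < n, w j < n + 1)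
    (neg_lt : ∀ w ∈ N₁, ∀ j < n, w j < n + 1)
    (card_pos : ∀ w ∈ P₁, (insert n ((Finset.range n).image w)).card ≤ k + 1)
    (card_pos' : ∀ w ∈ P₁, (insert 0 ((Finset.range n).image w)).card ≤ k + 2)
    (card_neg : ∀ w ∈ N₁, (insert 0 ((Finset.range n).image w)).card ≤ k + 1)
    (neg_ne_id : ∀ w ∈ N₁, ∃ j < n, w j ≠ j) :
    IsReduction (n + 1) (k + 1)
      (P.map (fun w => Function.update w n (w 0)) ++ P₁.map (fun w => Function.update w n n) ++
        N₁.map (fun w => Function.update w n 0))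
      (N.map (fun w => Function.update w n (w 0)) ++ N₁.map (fun w => Function.update w n n) ++
        P₁.map (fun w => Function.update w n 0)) := by
  have hcopy : ∀ w : ℕ → ℕ, insert (w 0) ((Finset.range n).image w) = (Finset.range n).image w :=
    fun w => Finset.insert_eq_of_mem (Finset.mem_image_of_mem _ (Finset.mem_range.2 hn))
  constructor
  · intro J hJ hcard F hF
    simp only [List.map_append, List.map_map, List.sum_append]
    by_cases hnJ : n ∈ J
    · have hsub : J.erase n ⊆ Finset.range n := by
        intro j hj
        have h1 := Finset.mem_range.1 (hJ (Finset.mem_of_mem_erase hj))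
        have h2 := Finset.ne_of_mem_erase hj
        exact Finset.mem_range.2 (by omega)
      have hc : (J.erase n).card ≤ k := by rw [Finset.card_erase_of_mem hnJ]; omega
      have hext : ∀ a, DependsOn (F ∘ fun w => Function.update w n a)
          ((J.erase n : Finset ℕ) : Set ℕ) := by
        intro a x y hxy
        refine hF fun j hj => ?_
        by_cases hjn : j = n
        · subst hjn; simp
        · simp only [Function.update_of_ne hjn]
          exact hxy j (by simpa [hjn] using hj)
      have e1 := h.sum_eq (insert 0 (J.erase n))
        (Finset.insert_subset (Finset.mem_range.2 hn) hsub)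
        ((Finset.card_insert_le _ _).trans (by omega))
        (F ∘ fun w => Function.update w n (w 0)) (by
          intro x y hxy
          refine hF fun j hj => ?_
          by_cases hjn : j = n
          · subst hjn
            simpa using hxy 0 (by simp)
          · simp only [Function.update_of_ne hjn]
            exact hxy j (by simp [hjn]; exact Or.inr hj))
      have e2 := sum_eq _ hsub hc _ (hext n)
      have e3 := sum_eq _ hsub hc _ (hext 0)
      have hid : Function.update (id : ℕ → ℕ) n n = id := Function.update_eq_self n id
      simp only [Function.comp_apply, id_eq] at e1 e2 e3
      rw [hid] at e2
      linarith
    · have hup : ∀ (w : ℕ → ℕ) (a : ℕ), F (Function.update w n a) = F w := by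
        intro w a
        refine hF fun j hj => Function.update_of_ne ?_ _ _
        rintro rfl
        exact hnJ hj
      have hsub : J ⊆ Finset.range n := by
        intro j hj
        have h1 := Finset.mem_range.1 (hJ hj)
        have h2 : j ≠ n := by rintro rfl; exact hnJ hj
        exact Finset.mem_range.2 (by omega)
      have e1 := h.sum_eq J hsub hcard F hF
      simp only [Function.comp_def, hup]
      linarith
  · intro w hw
    simp only [List.mem_append, List.mem_map] at hw
    rcases hw with (⟨w, hw, rfl⟩ | ⟨w, hw, rfl⟩) | ⟨w, hw, rfl⟩
    · exact update_lt (fun j hj => (h.pos_lt w hw j hj).trans n.lt_succ_self)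
        ((h.pos_lt w hw 0 hn).trans n.lt_succ_self)
    · exact update_lt (pos_lt w hw) n.lt_succ_self
    · exact update_lt (neg_lt w hw) n.succ_pos
  · intro w hw
    simp only [List.mem_append, List.mem_map] at hw
    rcases hw with (⟨w, hw, rfl⟩ | ⟨w, hw, rfl⟩) | ⟨w, hw, rfl⟩
    · exact update_lt (fun j hj => (h.neg_lt w hw j hj).trans n.lt_succ_self)
        ((h.neg_lt w hw 0 hn).trans n.lt_succ_self)
    · exact update_lt (neg_lt w hw) n.lt_succ_self
    · exact update_lt (pos_lt w hw) n.succ_pos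
  · intro w hw
    simp only [List.mem_append, List.mem_map] at hw
    rcases hw with (⟨w, hw, rfl⟩ | ⟨w, hw, rfl⟩) | ⟨w, hw, rfl⟩ <;>
      rw [image_range_succ_update]
    · rw [hcopy]; exact h.card_pos w hw
    · exact card_pos w hw
    · exact card_neg w hw
  · intro w hw
    simp only [List.mem_append, List.mem_map] at hw
    rcases hw with (⟨w, hw, rfl⟩ | ⟨w, hw, rfl⟩) | ⟨w, hw, rfl⟩ <;>
      rw [image_range_succ_update]
    · rw [hcopy]; exact h.card_neg w hw
    · rw [Finset.insert_comm]
      exact (Finset.card_insert_le _ _).trans (Nat.succ_le_succ (card_neg w hw))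
    · rw [Finset.insert_idem]; exact card_pos' w hw
  · intro w hw
    simp only [List.mem_append, List.mem_map] at hw
    rcases hw with (⟨w, hw, rfl⟩ | ⟨w, hw, rfl⟩) | ⟨w, hw, rfl⟩
    · by_cases h0 : w 0 = 0
      · exact ⟨n, n.lt_succ_self, by simp [h0]; omega⟩
      · exact ⟨0, n.succ_pos, by rw [Function.update_of_ne hn.ne]; exact h0⟩
    · obtain ⟨j, hj, hne⟩ := neg_ne_id w hw
      exact ⟨j, by omega, by rw [Function.update_of_ne hj.ne]; exact hne⟩
    · exact ⟨n, n.lt_succ_self, by simp; omega⟩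

theorem exists_isReduction (n k : ℕ) (hk : k < n) :
    ∃ P N, IsReduction n (k + 1) P N ∧ P.length + N.length = T n (k + 1) := by
  induction n generalizing k with
  | zero => omega
  | succ n ih =>
    rcases Nat.lt_succ_iff_lt_or_eq.1 hk with hlt | rfl
    · obtain ⟨P, N, h, hlen⟩ := ih k hlt
      rw [T_succ_succ n k hlt]
      cases k with
      | zero =>
        refine ⟨_, _, h.extend (P₁ := [fun _ => n]) (N₁ := []) hlt ?_ (by simp) (by simp)
          ?_ ?_ (by simp) (by simp), ?_⟩
        · intro J _ hJ F hF
          have : J = ∅ := by simpa using hJ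
          subst this
          simpa using hF (x := fun _ => n) (y := id) (by simp)
        · intro w hw
          obtain rfl := List.mem_singleton.1 hw
          refine (Finset.card_le_card (t := {n}) ?_).trans (by simp)
          intro a; simp; tauto
        · intro w hw
          obtain rfl := List.mem_singleton.1 hw
          refine (Finset.card_le_card (t := {0, n}) ?_).trans Finset.card_le_two
          intro a; simp; tauto
        · rw [T_zero_right, ← hlen]
          simp
          omega
      | succ k =>
        obtain ⟨P₁, N₁, h₁, hlen₁⟩ := ih k (by omega)
        refine ⟨_, _, h.extend (by omega) h₁.sum_eq
          (fun w hw j hj => (h₁.pos_lt w hw j hj).trans n.lt_succ_self)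
          (fun w hw j hj => (h₁.neg_lt w hw j hj).trans n.lt_succ_self)
          (fun w hw => (Finset.card_insert_le _ _).trans (Nat.succ_le_succ (h₁.card_pos w hw)))
          (fun w hw => (Finset.card_insert_le _ _).trans
            ((Nat.succ_le_succ (h₁.card_pos w hw)).trans (Nat.le_succ _)))
          h₁.card_neg h₁.neg_ne_id, ?_⟩
        simp; omega
    · exact ⟨_, _, isReduction_self (k + 1), by simp [T_self]⟩

/-- A list of rows of natural numbers less than `q` as an array. -/
theorem exists_array {q R : ℕ} (L : List (ℕ → ℕ)) (hR : L.length = R)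
    (hL : ∀ w ∈ L, ∀ j < q, w j < q) :
    ∃ A : Fin R → Fin q → Fin q, (∀ r, ∃ w ∈ L, ∀ j, (A r j : ℕ) = w j) ∧
      (∀ w ∈ L, ∃ r, ∀ j, (A r j : ℕ) = w j) ∧
      ∀ (p : (Fin q → ℕ) → Prop) [DecidablePred p],
        (((Finset.univ.filter fun r => p fun j => A r j).card : ℕ) : ℤ) =
          (L.map fun w => if p (fun j => w j) then (1 : ℤ) else 0).sum := by
  subst hR
  refine ⟨fun r j => ⟨L[r] j, hL _ (List.getElem_mem _) j j.2⟩,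
    fun r => ⟨L[r], List.getElem_mem _, fun j => rfl⟩, fun w hw => ?_, fun p _ => ?_⟩
  · obtain ⟨i, hi, rfl⟩ := List.getElem_of_mem hw
    exact ⟨⟨i, hi⟩, fun j => rfl⟩
  · rw [Finset.card_filter]
    push_cast
    exact Fin.sum_univ_fun_getElem L fun w => if p (fun j => w j) then (1 : ℤ) else 0

theorem IsReduction.gammaNonempty {q k : ℕ} {P N : List (ℕ → ℕ)} (h : IsReduction q k P N) :
    GammaNonempty P.length 1 q k k := by
  obtain ⟨Ψ, hΨ, -, hΨc⟩ := exists_array (q := q) P rfl h.pos_lt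
  obtain ⟨Φ, hΦ, hΦ', hΦc⟩ := exists_array (q := q) (id :: N) h.length_eq.symm (by
    intro w hw
    rcases List.mem_cons.1 hw with rfl | hw
    · exact fun j hj => hj
    · exact h.neg_lt w hw)
  refine ⟨Ψ, Φ, ⟨?_, ?_, ?_⟩, ?_⟩
  · obtain ⟨r, hr⟩ := hΦ' id List.mem_cons_self
    exact ⟨r, fun j => Fin.ext (hr j)⟩
  · intro r
    obtain ⟨w, hw, hrw⟩ := hΨ r
    refine le_trans ?_ (h.card_pos w hw)
    rw [← Finset.card_image_of_injective _ Fin.val_injective]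
    refine Finset.card_le_card fun a ha => ?_
    simp only [Finset.mem_image, Finset.mem_univ, true_and, exists_exists_eq_and] at ha
    obtain ⟨j, rfl⟩ := ha
    rw [hrw]
    exact Finset.mem_image_of_mem _ (Finset.mem_range.2 j.2)
  · intro c hc v
    have e1 := hΨc fun x => ∀ s, x (c s) = v s
    have e2 := hΦc fun x => ∀ s, x (c s) = v s
    have e3 := h.sum_eq (Finset.univ.image fun s => (c s : ℕ))
      (by intro a; simp only [Finset.mem_image, Finset.mem_range]; rintro ⟨s, -, rfl⟩; exact (c s).2)
      (Finset.card_image_le.trans (by simp))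
      (fun w => if ∀ s, w (c s) = v s then 1 else 0) (by
        intro x y hxy
        have : ∀ s, x (c s) = y (c s) := fun s => hxy _ (by simp)
        simp only [this])
    simp only [← Fin.ext_iff] at e1 e2
    rw [List.map_cons, List.sum_cons] at e2
    rw [← @Nat.cast_inj ℤ, e1, e2, e3, add_comm]
  · have e := hΦc fun x => ∀ j : Fin q, x j = j
    simp only [← Fin.ext_iff] at e
    rw [← @Nat.cast_inj ℤ, e, List.map_cons, List.sum_cons, List.sum_eq_zero]
    · simp
    · intro a ha
      obtain ⟨w, hw, rfl⟩ := List.mem_map.1 ha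
      obtain ⟨j, hj, hne⟩ := h.neg_ne_id w hw
      exact if_neg fun hall => hne (hall ⟨j, hj⟩)

/-- Arrays which agree on `k` columns agree on any statistic of at most `k` columns. -/
theorem IsARPA.sum_eq {q p k R : ℕ} {Ψ Φ : Fin R → Fin q → Fin q} (h : IsARPA q p k R Ψ Φ)
    (hkq : k ≤ q) (J : Finset (Fin q)) (hJ : J.card ≤ k) (F : (Fin q → Fin q) → ℕ)
    (hF : DependsOn F (J : Set (Fin q))) : ∑ r, F (Ψ r) = ∑ r, F (Φ r) := by
  obtain ⟨J', hJJ', hcard⟩ := Finset.exists_superset_card_eq hJ (by simpa using hkq)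
  set c := J'.orderEmbOfFin hcard with hc
  have hext : ∀ x : Fin q → Fin q, F x = F (Function.extend c (x ∘ c) id) := by
    intro x
    refine hF fun j hj => ?_
    have : j ∈ Set.range c := by
      rw [hc, Finset.range_orderEmbOfFin]
      exact hJJ' hj
    obtain ⟨s, rfl⟩ := this
    rw [c.injective.extend_apply, Function.comp_apply]
  have key : ∀ A : Fin R → Fin q → Fin q, ∑ r, F (A r) =
      ∑ v : Fin k → Fin q, (Finset.univ.filter fun r => ∀ s, A r (c s) = v s).card *
        F (Function.extend c v id) := by
    intro A
    rw [← Finset.sum_fiberwise Finset.univ (fun r => A r ∘ c)]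
    refine Finset.sum_congr rfl fun v _ => ?_
    rw [← smul_eq_mul, ← Finset.sum_const]
    refine Finset.sum_congr (by ext r; simp [funext_iff]) fun r hr => ?_
    rw [hext (A r)]
    congr 2
    exact funext (Finset.mem_filter.1 hr).2
  rw [key, key]
  exact Finset.sum_congr rfl fun v _ => by rw [h.2.2 c c.strictMono v]

/-- Extension of a row by the identity on additional columns. -/
def extendRow {m q : ℕ} (h : m ≤ q) (x : Fin m → Fin m) (j : Fin q) : Fin q :=
  if hj : (j : ℕ) < m then Fin.castLE h (x ⟨j, hj⟩) else j

theorem extendRow_eq_self_iff {m q : ℕ} (h : m ≤ q) (x : Fin m → Fin m) :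
    (∀ j, extendRow h x j = j) ↔ ∀ j, x j = j := by
  constructor
  · intro hx j
    have := hx (Fin.castLE h j)
    simpa [extendRow] using this
  · intro hx j
    unfold extendRow
    split_ifs with hj
    · rw [hx]; rfl
    · rfl

theorem GammaNonempty.extend {m q k p R Rs : ℕ} (h : GammaNonempty R Rs m k k) (hkm : k ≤ m)
    (hmq : m ≤ q) (hp : p = k + (q - m)) : GammaNonempty R Rs q p k := by
  obtain ⟨Ψ, Φ, hA, hcount⟩ := h
  refine ⟨fun r => extendRow hmq (Ψ r), fun r => extendRow hmq (Φ r), ⟨?_, ?_, ?_⟩, ?_⟩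
  · obtain ⟨r, hr⟩ := hA.1
    exact ⟨r, (extendRow_eq_self_iff hmq _).2 hr⟩
  · intro r
    have hsub : Finset.univ.image (extendRow hmq (Ψ r)) ⊆
        (Finset.univ.image (Ψ r)).image (Fin.castLE hmq) ∪
          (Finset.univ.image (Fin.castLE hmq))ᶜ := by
      intro a ha
      obtain ⟨j, -, rfl⟩ := Finset.mem_image.1 ha
      by_cases hj : (j : ℕ) < m
      · refine Finset.mem_union_left _ ?_
        simp [extendRow, hj]
      · refine Finset.mem_union_right _ ?_
        simp only [extendRow, hj, dite_false, Finset.mem_compl, Finset.mem_image, not_exists]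
        rintro i ⟨-, rfl⟩
        exact hj i.2
    refine (Finset.card_le_card hsub).trans ((Finset.card_union_le _ _).trans ?_)
    rw [Finset.card_compl, Finset.card_image_of_injective _ (Fin.castLE_injective hmq),
      Finset.card_image_of_injective _ (Fin.castLE_injective hmq), hp]
    simpa using hA.2.1 r
  · intro c hc v
    simp only [Finset.card_filter]
    refine hA.sum_eq hkm (Finset.univ.filter fun j => ∃ s, c s = Fin.castLE hmq j) ?_
      (fun x => if ∀ s, extendRow hmq x (c s) = v s then 1 else 0) ?_
    · rw [← Finset.card_image_of_injective _ (Fin.castLE_injective hmq)]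
      refine (Finset.card_le_card (t := Finset.univ.image c) ?_).trans
        (Finset.card_image_le.trans (by simp))
      intro a ha
      simp only [Finset.mem_image, Finset.mem_filter, Finset.mem_univ, true_and] at ha ⊢
      obtain ⟨j, ⟨s, hs⟩, rfl⟩ := ha
      exact ⟨s, hs⟩
    · intro x y hxy
      have : ∀ s, extendRow hmq x (c s) = extendRow hmq y (c s) := by
        intro s
        unfold extendRow
        split_ifs with hs
        · rw [hxy ⟨c s, hs⟩ (by simp only [Finset.coe_filter, Set.mem_ofPred_eq,
            Finset.mem_univ, true_and]; exact ⟨s, rfl⟩)]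
        · rfl
      simp only [this]
  · simpa only [extendRow_eq_self_iff] using hcount

theorem ratio_le_one {R Rs : ℕ} (h : Rs ≤ R) : (Rs : ℝ) / R ≤ 1 :=
  div_le_one_of_le₀ (by exact_mod_cast h) (Nat.cast_nonneg R)

theorem GammaNonempty.ratio_le_gammaARPA {q p k R Rs : ℕ} (h : GammaNonempty R Rs q p k)
    (h0 : 0 < Rs) (hle : Rs ≤ R) : (Rs : ℝ) / R ≤ gammaARPA q p k := by
  refine le_csSup ⟨1, ?_⟩ ⟨R, Rs, h0, hle, h, rfl⟩
  rintro x ⟨R, Rs, -, hle, -, rfl⟩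
  exact ratio_le_one hle

theorem gammaARPA_nonneg (q p k : ℕ) : 0 ≤ gammaARPA q p k := by
  refine Real.sSup_nonneg ?_
  rintro x ⟨R, Rs, -, -, -, rfl⟩
  positivity

theorem gammaARPA_le {q p k : ℕ} {a : ℝ} (ha : 0 ≤ a)
    (h : ∀ R Rs : ℕ, 0 < Rs → Rs ≤ R → GammaNonempty R Rs q p k → (Rs : ℝ) / R ≤ a) :
    gammaARPA q p k ≤ a := by
  refine Real.sSup_le ?_ ha
  rintro x ⟨R, Rs, h0, hle, hne, rfl⟩
  exact h R Rs h0 hle hne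

theorem gammaNonempty_self (q k : ℕ) : GammaNonempty 1 1 q q k :=
  ⟨fun _ j => j, fun _ j => j,
    ⟨⟨0, fun _ => rfl⟩, fun _ => (Finset.card_le_univ _).trans (by simp), fun _ _ _ => rfl⟩,
    by simp⟩

/-- Let `k ≥ 1`, `p ≥ k` and `q ≥ p`. Then:
(i) `γ(q,q,k) = 1`;
(ii) if `p > k`, then `γ(q,p,k) ≥ γ(q−p+k, k, k)`;
(iii) if `p = k < q`, then `(T(q,k)+1)/2` is an integer, `Γ((T(q,k)+1)/2, 1, q, k, k)` is
nonempty, and consequently `γ(q,k,k) ≥ 2/(T(q,k)+1)`. -/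
theorem gammaARPA_lower_bounds (q p k : ℕ) (hk : 1 ≤ k) (hpk : k ≤ p) (hqp : p ≤ q) :
    (p = q → gammaARPA q q k = 1) ∧
    (k < p → gammaARPA (q - p + k) k k ≤ gammaARPA q p k) ∧
    (p = k → k < q →
      2 ∣ (T q k + 1) ∧
      GammaNonempty ((T q k + 1) / 2) 1 q k k ∧
      2 / ((T q k : ℝ) + 1) ≤ gammaARPA q k k) := by
  refine ⟨?_, ?_, ?_⟩
  · rintro rfl
    refine le_antisymm (gammaARPA_le zero_le_one fun R Rs _ hle _ => ratio_le_one hle) ?_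
    simpa using (gammaNonempty_self p k).ratio_le_gammaARPA one_pos le_rfl
  · intro hlt
    exact gammaARPA_le (gammaARPA_nonneg _ _ _) fun R Rs h0 hle h =>
      (h.extend (by omega) (by omega) (by omega)).ratio_le_gammaARPA h0 hle
  · rintro rfl hlt
    obtain ⟨k, rfl⟩ : ∃ k, p = k + 1 := ⟨p - 1, by omega⟩
    obtain ⟨P, N, h, hlen⟩ := exists_isReduction q k (by omega)
    have hT : T q (k + 1) + 1 = 2 * P.length := by have := h.length_eq; omega
    have hpos : 1 ≤ P.length := by have := h.length_eq; omega
    refine ⟨⟨_, hT⟩, ?_, ?_⟩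
    · rw [hT, Nat.mul_div_cancel_left _ two_pos]
      exact h.gammaNonempty
    · refine le_of_eq_of_le ?_ (h.gammaNonempty.ratio_le_gammaARPA one_pos hpos)
      have hT' : (T q (k + 1) : ℝ) + 1 = 2 * P.length := by exact_mod_cast hT
      have : (P.length : ℝ) ≠ 0 := by exact_mod_cast (by omega : P.length ≠ 0)
      rw [hT']
      field_simp
      simp
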